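/- arXiv:math/0104053 — 2 statements merged into one kernel-verified Lean document; each statement's English description precedes it below -/
import Mathlib

section
/- For all integers ν ≥ 1 and s: (i) B^ν_{s,ν+2}(L,q) = B^ν_{2ν+3−s,ν+1}(L,q) for all L ≥ 0 with L ≡ s + ν (mod 2); and (ii) B^ν_{s,1}(L,q) = B^ν_{s,2}(L−1,q) for all L ≥ 1 with L ≡ s + 1 (mod 2). -/
open scoped Classical

noncomputable section

/-- The q-Pochhammer symbol `(q)_n = ∏_{j=1}^n (1 - q^j)`. -/
def qP {F : Type*} [Field F] (q : F) (n : ℕ) : F :=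
  ∏ j ∈ Finset.range n, (1 - q ^ (j + 1))

/-- The q-binomial coefficient `[N choose k]_q = (q)_N / ((q)_k (q)_{N-k})`
for `0 ≤ k ≤ N`, and `0` otherwise. -/
def qB {F : Type*} [Field F] (q : F) (N k : ℤ) : F :=
  if 0 ≤ k ∧ k ≤ N then qP q N.toNat / (qP q k.toNat * qP q (N - k).toNat) else 0

/-- `NN n i = N_i = n_i + n_{i+1} + ⋯ + n_ν` (indices 1-based; `n ⟨k⟩` is `n_{k+1}`). -/
def NN {ν : ℕ} (n : Fin ν → ℕ) (i : ℕ) : ℕ :=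
  ∑ k : Fin ν, if i ≤ (k : ℕ) + 1 then n k else 0

/-- `α_{i,s} = max(0, i - s)`. -/
def alph (i s : ℕ) : ℤ := max 0 ((i : ℤ) - s)

/-- The exponent `N_1² + ⋯ + N_ν² + N_{s+1} + ⋯ + N_ν`. -/
def expAG (ν s : ℕ) (nn : Fin ν → ℕ) : ℕ :=
  (∑ i ∈ Finset.Icc 1 ν, (NN nn i) ^ 2) + ∑ i ∈ Finset.Icc (s + 1) ν, NN nn i

/-- The polynomial `B^ν_{s,b}(L,q)` of Foda–Quano–Kirillov type. -/
def B {F : Type*} [Field F] (ν : ℕ) (s b : ℤ) (L : ℕ) (q : F) : F :=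
  ∑ᶠ j : ℤ,
    (q ^ (j * ((2 * j + 1) * (2 * (ν : ℤ) + 3) - 2 * s)) *
        qB q (L : ℤ) (((L : ℤ) + b - s) / 2 + j * (2 * (ν : ℤ) + 3)) -
      q ^ ((2 * j + 1) * ((2 * (ν : ℤ) + 3) * j + s)) *
        qB q (L : ℤ) (((L : ℤ) + b + s) / 2 + j * (2 * (ν : ℤ) + 3)))

/-- `jjf j l = j_l` for `1 ≤ l ≤ ν` (and junk value `0` otherwise). -/
def jjf {ν : ℕ} (j : Fin ν → ℕ) (l : ℕ) : ℤ :=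
  if h : l - 1 < ν then (j ⟨l - 1, h⟩ : ℤ) else 0

/-- The q-multinomial coefficient `[L choose a]^(p)_ν`. -/
def qMulti {F : Type*} [Field F] (ν L : ℕ) (a : ℤ) (p : ℕ) (q : F) : F :=
  ∑ᶠ j : Fin ν → ℕ,
    if (∑ l, (j l : ℤ)) = a then
      q ^ ((∑ l ∈ Finset.Icc 2 ν, jjf j (l - 1) * ((L : ℤ) - jjf j l)) -
            ∑ l ∈ Finset.Icc 1 p, jjf j l) *
        qB q (L : ℤ) (jjf j ν) * ∏ l ∈ Finset.Icc 2 ν, qB q (jjf j l) (jjf j (l - 1))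
    else 0

/-- The polynomial `W^ν_{s,b}(L,q)` of Warnaar type. -/
def W {F : Type*} [Field F] (ν : ℕ) (s : ℤ) (b L : ℕ) (q : F) : F :=
  ∑ᶠ j : ℤ,
    (q ^ (j * ((2 * j + 1) * (2 * (ν : ℤ) + 3) - 2 * s)) *
        qMulti ν L (((ν : ℤ) * ((L : ℤ) + 1) - s - b + 1) / 2 + (2 * (ν : ℤ) + 3) * j) b q -
      q ^ ((2 * j + 1) * ((2 * (ν : ℤ) + 3) * j + s)) *
        qMulti ν L (((ν : ℤ) * ((L : ℤ) + 1) + s - b + 1) / 2 + (2 * (ν : ℤ) + 3) * j) b q)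

/-! ### Bressoud lattice paths -/

/-- Step values: `0 ↦ NE (+1)`, `1 ↦ SE (−1)`, `2 ↦ horizontal (0)`. -/
def stepVal : Fin 3 → ℤ := ![1, -1, 0]

/-- Height of the path after `k` steps, starting at height `s`. -/
def hts (s : ℤ) {n : ℕ} (d : Fin n → Fin 3) (k : ℕ) : ℤ :=
  s + ∑ i ∈ Finset.range k, if h : i < n then stepVal (d ⟨i, h⟩) else 0

/-- The vertex `k` is a peak: it is preceded by a NE step and followed by a SE step. -/
def IsPeak {n : ℕ} (d : Fin n → Fin 3) (k : ℕ) : Prop :=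
  ∃ hk : k < n, 1 ≤ k ∧ d ⟨k - 1, Nat.lt_of_le_of_lt (Nat.sub_le k 1) hk⟩ = 0 ∧ d ⟨k, hk⟩ = 1

/-- `d` encodes a Bressoud path from height `s` to height `b` whose peaks have height `≤ ν`:
SE steps only from positive height, horizontal steps only on the x-axis. -/
def ValidPath (ν : ℕ) (s b : ℤ) {n : ℕ} (d : Fin n → Fin 3) : Prop :=
  hts s d n = b ∧
    (∀ k : Fin n, (d k = 1 → 0 < hts s d (k : ℕ)) ∧ (d k = 2 → hts s d (k : ℕ) = 0)) ∧
    (∀ k : ℕ, IsPeak d k → hts s d k ≤ (ν : ℤ))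

/-- The weight of a Bressoud path starting at x-coordinate `M`:
the sum of the x-coordinates of its peaks. -/
def pwt (M : ℤ) {n : ℕ} (d : Fin n → Fin 3) : ℤ :=
  ∑ k ∈ Finset.range (n + 1), if IsPeak d k then M + (k : ℤ) else 0

/-- `C^ν_{M,L}(s,b,q)`: the weighted count of Bressoud paths from `(M,s)` to `(L,b)`
with no peak higher than `ν`. -/
def Cpoly {F : Type*} [Field F] (ν : ℕ) (M L : ℤ) (s b : ℕ) (q : F) : F :=
  ∑ d ∈ Finset.univ.filter (fun d : Fin (L - M).toNat → Fin 3 => ValidPath ν (s : ℤ) (b : ℤ) d),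
    q ^ pwt M d

/-- `t` is an admissible relative height for the peak at vertex `k`. -/
def RelProp (s : ℤ) {n : ℕ} (d : Fin n → Fin 3) (k t : ℕ) : Prop :=
  0 < t ∧ ∃ k' k'' : ℕ, k' < k ∧ k < k'' ∧ k'' ≤ n ∧
    hts s d k' = hts s d k - t ∧ hts s d k'' = hts s d k - t ∧
    ∀ m : ℕ, k' < m → m < k'' → IsPeak d m →
      hts s d m ≤ hts s d k ∧ (hts s d m = hts s d k → k ≤ m)

/-- The relative height of the peak at vertex `k`: the largest `t` with `RelProp`. -/
def relHt (ν : ℕ) (s : ℤ) {n : ℕ} (d : Fin n → Fin 3) (k : ℕ) : ℕ :=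
  Nat.findGreatest (RelProp s d k) (ν + n)

/-- `P^ν_{M,L}(s,b,n)`: Bressoud paths from `(M,s)` to `(L,b)`, peaks of height at most `ν`,
with exactly `nn j` peaks of relative height `j+1`. -/
def Pset (ν : ℕ) (M L : ℤ) (s b : ℤ) (nn : Fin ν → ℕ) : Finset (Fin (L - M).toNat → Fin 3) :=
  Finset.univ.filter (fun d => ValidPath ν s b d ∧
    ∀ j : Fin ν, ((Finset.range ((L - M).toNat + 1)).filter
      (fun k => IsPeak d k ∧ relHt ν s d k = (j : ℕ) + 1)).card = nn j)

/-! ### Gordon lattice paths -/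

/-- `f` encodes a Gordon path of length `n` from height `s` to height `b`:
`f 0 = s`, `f n = b`, adjacent frequencies sum to at most `ν`; values beyond `n` are `0`. -/
def IsGordon (ν n s b : ℕ) (f : ℕ → ℕ) : Prop :=
  f 0 = s ∧ f n = b ∧ (∀ k, k < n → f k + f (k + 1) ≤ ν) ∧ (∀ k, n < k → f k = 0)

/-- The weight `Σ_{j=M+1}^{L-1} j f_j` of a Gordon path starting at x-coordinate `M`. -/
def gwt (M : ℤ) (n : ℕ) (f : ℕ → ℕ) : ℤ :=
  ∑ k ∈ Finset.Ioo 0 n, (M + (k : ℤ)) * (f k : ℤ)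

/-- `G^ν_{M,L}(s,b,q)`: the weighted count of Gordon paths from `(M,s)` to `(L,b)`. -/
def G {F : Type*} [Field F] (ν : ℕ) (M L : ℤ) (s b : ℕ) (q : F) : F :=
  ∑ᶠ f : ℕ → ℕ, if IsGordon ν (L - M).toNat s b f then q ^ gwt M (L - M).toNat f else 0

/-- `F^ν_{s,b}(L,q)` of (2.21). -/
def Fpoly {F : Type*} [Field F] (ν s b L : ℕ) (q : F) : F :=
  ∑ᶠ nn : Fin ν → ℕ, q ^ expAG ν s nn *
    ∏ i : Fin ν, qB q ((nn i : ℤ) + ((i : ℕ) + 1) * (L : ℤ) -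
      2 * (∑ l ∈ Finset.Icc 1 ((i : ℕ) + 1), (NN nn l : ℤ)) -
      alph ((i : ℕ) + 1) s - alph ((i : ℕ) + 1) b) (nn i)

/-- The left-hand side of (4.2): `F` with the extra `−M(N_1+⋯+N_ν)` in the exponent. -/
def FpolyM {F : Type*} [Field F] (ν s b L M : ℕ) (q : F) : F :=
  ∑ᶠ nn : Fin ν → ℕ,
    q ^ ((expAG ν s nn : ℤ) - (M : ℤ) * ∑ i ∈ Finset.Icc 1 ν, (NN nn i : ℤ)) *
    ∏ i : Fin ν, qB q ((nn i : ℤ) + ((i : ℕ) + 1) * (L : ℤ) -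
      2 * (∑ l ∈ Finset.Icc 1 ((i : ℕ) + 1), (NN nn l : ℤ)) -
      alph ((i : ℕ) + 1) s - alph ((i : ℕ) + 1) b) (nn i)


abbrev K : Type := RatFunc ℚ


lemma aux_qP_ne (n : ℕ) : qP (RatFunc.X : K) n ≠ 0 := by
  unfold qP
  rw [Finset.prod_ne_zero_iff]
  intro j _ h
  have h1 : (RatFunc.X : K) ^ (j+1) = 1 := (sub_eq_zero.mp h).symm
  rw [← RatFunc.algebraMap_X, ← map_pow, ← map_one (algebraMap (Polynomial ℚ) (RatFunc ℚ))] at h1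
  have h2 := RatFunc.algebraMap_injective ℚ h1
  have h3 := congrArg Polynomial.natDegree h2
  simp at h3

lemma aux_qP_succ (n : ℕ) : qP (RatFunc.X : K) (n+1) = qP (RatFunc.X : K) n * (1 - RatFunc.X ^ (n+1)) := by
  unfold qP
  rw [Finset.prod_range_succ]

lemma aux_symm (N k : ℤ) : qB (RatFunc.X : K) N (N - k) = qB RatFunc.X N k := by
  unfold qB
  by_cases h : 0 ≤ k ∧ k ≤ N
  · rw [if_pos h, if_pos (by omega), sub_sub_cancel, mul_comm (qP _ k.toNat)]
  · rw [if_neg h, if_neg (by omega)]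

lemma aux_pascal (N k : ℤ) (hN : 1 ≤ N) : qB (RatFunc.X : K) N k =
    qB RatFunc.X (N-1) k + RatFunc.X ^ (N - k) * qB RatFunc.X (N-1) (k-1) := by
  by_cases h : 0 ≤ k ∧ k ≤ N
  · by_cases h0 : k = 0
    · subst h0
      unfold qB
      rw [if_pos (by omega), if_pos (by omega), if_neg (by omega)]
      have z : qP (RatFunc.X : K) 0 = 1 := by simp [qP]
      simp only [sub_zero, sub_self, Int.toNat_zero, z, one_mul, mul_one, mul_zero, add_zero, zero_add, zpow_zero]
      rw [div_self (aux_qP_ne _), div_self (aux_qP_ne _)]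
    · by_cases h1 : k = N
      · subst h1
        unfold qB
        rw [if_pos (by omega), if_neg (by omega), if_pos (by omega)]
        have z : qP (RatFunc.X : K) 0 = 1 := by simp [qP]
        simp only [sub_zero, sub_self, Int.toNat_zero, z, one_mul, mul_one, mul_zero, add_zero, zero_add, zpow_zero]
        rw [div_self (aux_qP_ne _), div_self (aux_qP_ne _)]
      · obtain ⟨a, rfl⟩ : ∃ a : ℕ, k = a + 1 := ⟨(k-1).toNat, by omega⟩
        obtain ⟨b, rfl⟩ : ∃ b : ℕ, N = a + b + 2 := ⟨(N-a-2).toNat, by omega⟩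
        unfold qB
        rw [if_pos (by omega), if_pos (by omega), if_pos (by omega)]
        have e1 : ((a:ℤ)+b+2).toNat = (a+b+1)+1 := by omega
        have e2 : ((a:ℤ)+1).toNat = a+1 := by omega
        have e3 : ((a:ℤ)+b+2-(a+1)).toNat = b+1 := by omega
        have e4 : ((a:ℤ)+b+2-1).toNat = a+b+1 := by omega
        have e5 : ((a:ℤ)+b+2-1-(a+1)).toNat = b := by omega
        have e6 : ((a:ℤ)+1-1).toNat = a := by omega
        have e7 : ((a:ℤ)+b+2-1-(a+1-1)).toNat = b+1 := by omega
        have e8 : ((a:ℤ)+b+2-(a+1)) = ((b+1 : ℕ):ℤ) := by push_cast; ring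
        rw [e1,e2,e3,e4,e5,e6,e7,e8,zpow_natCast]
        have ha := aux_qP_ne (a+1)
        have hb := aux_qP_ne (b+1)
        rw [aux_qP_succ] at ha hb
        have ha1 := left_ne_zero_of_mul ha
        have ha2 := right_ne_zero_of_mul ha
        have hb1 := left_ne_zero_of_mul hb
        have hb2 := right_ne_zero_of_mul hb
        rw [aux_qP_succ (a+b+1), aux_qP_succ a, aux_qP_succ b]
        field_simp
        ring
  · unfold qB
    rw [if_neg h, if_neg (by omega), if_neg (by omega)]
    simp

lemma aux_fin (g : ℤ → K) (N c P : ℤ) (hP : 0 < P) :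
    (Function.support (fun j : ℤ => g j * qB (RatFunc.X : K) N (c + j * P))).Finite := by
  apply Set.Finite.subset ((Set.finite_Icc (0:ℤ) N).preimage (f := fun j : ℤ => c + j * P) ?_)
  · intro j hj
    by_contra hc
    apply hj
    simp only [Set.mem_preimage, Set.mem_Icc] at hc
    simp only [qB]
    rw [if_neg hc, mul_zero]
  · intro x _ y _ h
    simp only at h
    exact mul_right_cancel₀ hP.ne' (by linarith)

theorem stmt_6 (ν : ℕ) (hν : 1 ≤ ν) (s : ℤ) :
    (∀ L : ℕ, (L : ℤ) ≡ s + ν [ZMOD 2] →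
      B ν s ((ν : ℤ) + 2) L (RatFunc.X : K) = B ν (2 * (ν : ℤ) + 3 - s) ((ν : ℤ) + 1) L RatFunc.X) ∧
    (∀ L : ℕ, 1 ≤ L → (L : ℤ) ≡ s + 1 [ZMOD 2] →
      B ν s 1 L (RatFunc.X : K) = B ν s 2 (L - 1) RatFunc.X) := by
  have hP : (0:ℤ) < 2 * (ν:ℤ) + 3 := by omega
  constructor
  · intro L hL
    unfold Int.ModEq at hL
    obtain ⟨m, hm⟩ : ∃ m : ℤ, (L:ℤ) = s + ν + 2 * m := ⟨((L:ℤ) - s - ν) / 2, by omega⟩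
    unfold B
    rw [finsum_sub_distrib (aux_fin _ _ _ _ hP) (aux_fin _ _ _ _ hP),
      finsum_sub_distrib (aux_fin _ _ _ _ hP) (aux_fin _ _ _ _ hP)]
    congr 1
    · rw [← finsum_comp_equiv (Equiv.neg ℤ)]
      apply finsum_congr
      intro j
      rw [← aux_symm]
      simp only [Equiv.neg_apply]
      congr 2
      · ring
      · rw [show ((L:ℤ) + (ν + 2) - s) / 2 = ν + 1 + m by omega,
          show ((L:ℤ) + (ν + 1) - (2 * ν + 3 - s)) / 2 = s + m - 1 by omega, hm]
        ring
    · rw [← finsum_comp_equiv (Equiv.subLeft (-1 : ℤ))]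
      apply finsum_congr
      intro j
      rw [← aux_symm]
      simp only [Equiv.subLeft_apply]
      congr 2
      · ring
      · rw [show ((L:ℤ) + (ν + 2) + s) / 2 = ν + 1 + m + s by omega,
          show ((L:ℤ) + (ν + 1) + (2 * ν + 3 - s)) / 2 = 2 * ν + 2 + m by omega, hm]
        ring
  · intro L hL1 hL
    unfold Int.ModEq at hL
    obtain ⟨m, hm⟩ : ∃ m : ℤ, (L:ℤ) = s + 1 + 2 * m := ⟨((L:ℤ) - s - 1) / 2, by omega⟩
    have hc : ((L - 1 : ℕ) : ℤ) = (L:ℤ) - 1 := by omega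
    have hX : (RatFunc.X : K) ≠ 0 := RatFunc.X_ne_zero
    unfold B
    rw [hc, show ((L:ℤ) + 1 - s) / 2 = m + 1 by omega,
      show ((L:ℤ) + 1 + s) / 2 = m + 1 + s by omega,
      show ((L:ℤ) - 1 + 2 - s) / 2 = m + 1 by omega,
      show ((L:ℤ) - 1 + 2 + s) / 2 = m + 1 + s by omega]
    set P : ℤ := 2 * (ν:ℤ) + 3 with hPd
    let h : ℤ → K := fun j => RatFunc.X ^ (2 * P * j ^ 2 - 2 * j * s + s + m) *
      qB RatFunc.X ((L:ℤ) - 1) (m + j * P)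
    have hf : (Function.support h).Finite := aux_fin _ _ _ _ hP
    have hf2 : (Function.support (fun j => h j - h j)).Finite := by simp
    rw [finsum_sub_distrib (aux_fin _ _ _ _ hP) (aux_fin _ _ _ _ hP),
      finsum_sub_distrib (aux_fin _ _ _ _ hP) (aux_fin _ _ _ _ hP)]
    have E1 : ∀ j : ℤ, (RatFunc.X : K) ^ (j * ((2 * j + 1) * P - 2 * s)) *
        qB RatFunc.X (L:ℤ) (m + 1 + j * P) =
        (RatFunc.X : K) ^ (j * ((2 * j + 1) * P - 2 * s)) *
        qB RatFunc.X ((L:ℤ) - 1) (m + 1 + j * P) + h j := by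
      intro j
      rw [aux_pascal _ _ (by omega), mul_add, ← mul_assoc, ← zpow_add₀ hX]
      simp only [h]
      congr 3
      · rw [hm]; ring
      · ring
    have E2 : ∀ j : ℤ, (RatFunc.X : K) ^ ((2 * j + 1) * (P * j + s)) *
        qB RatFunc.X (L:ℤ) (m + 1 + s + j * P) =
        (RatFunc.X : K) ^ ((2 * j + 1) * (P * j + s)) *
        qB RatFunc.X ((L:ℤ) - 1) (m + 1 + s + j * P) + h (-j) := by
      intro j
      rw [aux_pascal _ _ (by omega), mul_add, ← mul_assoc, ← zpow_add₀ hX]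
      simp only [h]
      rw [← aux_symm ((L:ℤ) - 1) (m + -j * P)]
      congr 3
      · rw [hm]; ring
      · rw [hm]; ring
    have hfn : (Function.support (fun j => h (-j))).Finite :=
      hf.preimage (f := fun j : ℤ => -j) (neg_injective.injOn)
    rw [finsum_congr E1, finsum_congr E2,
      finsum_add_distrib (aux_fin _ _ _ _ hP) hf, finsum_add_distrib (aux_fin _ _ _ _ hP) hfn]
    have := finsum_comp_equiv (Equiv.neg ℤ) (f := h)
    simp only [Equiv.neg_apply] at this
    rw [this]
    ring

end
end

section
/- For all integers ν ≥ 1, 0 ≤ s, b ≤ ν, and L ≥ 0, the following identity of polynomials in q holds: C^ν_{0,L}(s,b,q) = B^ν_{ν+1−s,ν+1−b}(L,q) if L ≡ s + b (mod 2), and C^ν_{0,L}(s,b,q) = B^ν_{ν+2+s,ν+1−b}(L,q) if L ≢ s + b (mod 2). -/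
open scoped Classical

noncomputable section

/-! ### Helper lemmas: path side -/

def lastUp {n : ℕ} (d : Fin n → Fin 3) : Prop :=
  ∃ h : 0 < n, d ⟨n - 1, Nat.sub_lt h Nat.one_pos⟩ = 0

lemma snoc_lt {n : ℕ} (d : Fin n → Fin 3) (x : Fin 3) (k : ℕ) (hk : k < n) (h : k < n + 1) :
    (Fin.snoc d x : Fin (n + 1) → Fin 3) ⟨k, h⟩ = d ⟨k, hk⟩ := by
  have : (⟨k, h⟩ : Fin (n + 1)) = Fin.castSucc ⟨k, hk⟩ := rfl
  rw [this, Fin.snoc_castSucc (α := fun _ => Fin 3)]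

lemma snoc_eq {n : ℕ} (d : Fin n → Fin 3) (x : Fin 3) (h : n < n + 1) :
    (Fin.snoc d x : Fin (n + 1) → Fin 3) ⟨n, h⟩ = x := by
  have : (⟨n, h⟩ : Fin (n + 1)) = Fin.last n := rfl
  rw [this, Fin.snoc_last (α := fun _ => Fin 3)]

lemma hts_snoc_le (s : ℤ) {n : ℕ} (d : Fin n → Fin 3) (x : Fin 3) (k : ℕ) (hk : k ≤ n) :
    hts s (Fin.snoc d x : Fin (n + 1) → Fin 3) k = hts s d k := by
  unfold hts
  congr 1
  apply Finset.sum_congr rfl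
  intro i hi
  have hi' : i < n := lt_of_lt_of_le (Finset.mem_range.mp hi) hk
  have hi2 : i < n + 1 := by omega
  simp only [hi', hi2, dif_pos]
  rw [snoc_lt d x i hi']

lemma hts_snoc_last (s : ℤ) {n : ℕ} (d : Fin n → Fin 3) (x : Fin 3) :
    hts s (Fin.snoc d x : Fin (n + 1) → Fin 3) (n + 1) = hts s d n + stepVal x := by
  have h1 := hts_snoc_le s d x n le_rfl
  unfold hts at h1 ⊢
  rw [Finset.sum_range_succ, ← add_assoc, h1]
  congr 1
  simp only [Nat.lt_succ_self, dif_pos]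
  rw [snoc_eq]

lemma isPeak_snoc {n : ℕ} (d : Fin n → Fin 3) (x : Fin 3) (k : ℕ) :
    IsPeak (Fin.snoc d x : Fin (n + 1) → Fin 3) k ↔
      IsPeak d k ∨ (k = n ∧ lastUp d ∧ x = 1) := by
  constructor
  · rintro ⟨hk, h1, h2, h3⟩
    rcases Nat.lt_or_ge k n with h | h
    · left
      refine ⟨h, h1, ?_, ?_⟩
      · rwa [snoc_lt d x (k - 1) (by omega)] at h2
      · rwa [snoc_lt d x k h] at h3
    · right
      obtain rfl : k = n := by omega
      refine ⟨rfl, ⟨by omega, ?_⟩, ?_⟩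
      · rwa [snoc_lt d x (k - 1) (by omega)] at h2
      · rwa [snoc_eq] at h3
  · rintro (⟨hk, h1, h2, h3⟩ | ⟨rfl, ⟨h1, h2⟩, h3⟩)
    · refine ⟨by omega, h1, ?_, ?_⟩
      · rwa [snoc_lt d x (k - 1) (by omega)]
      · rwa [snoc_lt d x k hk]
    · refine ⟨by omega, h1, ?_, ?_⟩
      · rwa [snoc_lt d x (k - 1) (by omega)]
      · rwa [snoc_eq]

lemma lastUp_snoc {n : ℕ} (d : Fin n → Fin 3) (x : Fin 3) :
    lastUp (Fin.snoc d x : Fin (n + 1) → Fin 3) ↔ x = 0 := by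
  constructor
  · rintro ⟨_, h⟩
    have := snoc_eq d x (Nat.lt_succ_self n)
    simp only [Nat.add_sub_cancel] at h
    rw [← this]; exact h
  · intro h
    refine ⟨by omega, ?_⟩
    simp only [Nat.add_sub_cancel]
    rw [snoc_eq]; exact h

lemma not_isPeak_ge {n : ℕ} (d : Fin n → Fin 3) (k : ℕ) (h : n ≤ k) : ¬ IsPeak d k := by
  rintro ⟨hk, _⟩; omega

lemma pwt_snoc {n : ℕ} (d : Fin n → Fin 3) (x : Fin 3) :
    pwt 0 (Fin.snoc d x : Fin (n + 1) → Fin 3) =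
      pwt 0 d + if lastUp d ∧ x = 1 then (n : ℤ) else 0 := by
  unfold pwt
  rw [Finset.sum_range_succ, if_neg (not_isPeak_ge _ _ le_rfl), add_zero]
  rw [Finset.sum_range_succ, Finset.sum_range_succ (n := n), if_neg (not_isPeak_ge d n le_rfl), add_zero]
  congr 1
  · apply Finset.sum_congr rfl
    intro i hi
    have hi' : i < n := Finset.mem_range.mp hi
    have : IsPeak (Fin.snoc d x : Fin (n + 1) → Fin 3) i ↔ IsPeak d i := by
      rw [isPeak_snoc]
      constructor
      · rintro (h | h)
        · exact h
        · omega
      · exact Or.inl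
    simp only [this]
  · have : IsPeak (Fin.snoc d x : Fin (n + 1) → Fin 3) n ↔ (lastUp d ∧ x = 1) := by
      rw [isPeak_snoc]
      have := not_isPeak_ge d n le_rfl
      tauto
    simp only [this, zero_add]

lemma valid_snoc (ν : ℕ) (s b : ℤ) {n : ℕ} (d : Fin n → Fin 3) (x : Fin 3) :
    ValidPath ν s b (Fin.snoc d x : Fin (n + 1) → Fin 3) ↔
      ValidPath ν s (b - stepVal x) d ∧ (x = 1 → 0 < b - stepVal x) ∧
        (x = 2 → b - stepVal x = 0) ∧ (x = 1 → lastUp d → b - stepVal x ≤ ν) := by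
  unfold ValidPath
  rw [hts_snoc_last]
  constructor
  · rintro ⟨h1, h2, h3⟩
    have hb : hts s d n = b - stepVal x := by omega
    refine ⟨⟨hb, ?_, ?_⟩, ?_, ?_, ?_⟩
    · intro k
      have := h2 k.castSucc
      rw [Fin.snoc_castSucc (α := fun _ => Fin 3)] at this
      rwa [Fin.val_castSucc, hts_snoc_le s d x k k.2.le] at this
    · intro k hk
      have hk' : k < n := hk.1
      have := h3 k ((isPeak_snoc d x k).2 (Or.inl hk))
      rwa [hts_snoc_le s d x k hk'.le] at this
    · intro hx
      have := (h2 (Fin.last n)).1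
      rw [Fin.snoc_last (α := fun _ => Fin 3), Fin.val_last, hts_snoc_le s d x n le_rfl, hb] at this
      exact this hx
    · intro hx
      have := (h2 (Fin.last n)).2
      rw [Fin.snoc_last (α := fun _ => Fin 3), Fin.val_last, hts_snoc_le s d x n le_rfl, hb] at this
      exact this hx
    · intro hx hl
      have := h3 n ((isPeak_snoc d x n).2 (Or.inr ⟨rfl, hl, hx⟩))
      rwa [hts_snoc_le s d x n le_rfl, hb] at this
  · rintro ⟨⟨hb, h2, h3⟩, h4, h5, h6⟩
    refine ⟨by omega, ?_, ?_⟩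
    · intro k
      refine Fin.lastCases ?_ ?_ k
      · rw [Fin.snoc_last (α := fun _ => Fin 3), Fin.val_last, hts_snoc_le s d x n le_rfl, hb]
        exact ⟨h4, h5⟩
      · intro i
        rw [Fin.snoc_castSucc (α := fun _ => Fin 3), Fin.val_castSucc, hts_snoc_le s d x i i.2.le]
        exact h2 i
    · intro k hk
      rcases (isPeak_snoc d x k).1 hk with h | ⟨rfl, hl, hx⟩
      · have hk' : k < n := h.1
        rw [hts_snoc_le s d x k hk'.le]
        exact h3 k h
      · rw [hts_snoc_le s d x _ le_rfl, hb]
        exact h6 hx hl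

section paths
variable {F : Type*} [Field F] (q : F) (ν : ℕ) (s : ℤ)

/-- Weighted count of paths whose last step is NE. -/
def Up (n : ℕ) (b : ℤ) : F :=
  ∑ d : Fin n → Fin 3, if ValidPath ν s b d ∧ lastUp d then q ^ pwt 0 d else 0

/-- Weighted count of paths whose last step is not NE. -/
def Dn (n : ℕ) (b : ℤ) : F :=
  ∑ d : Fin n → Fin 3, if ValidPath ν s b d ∧ ¬ lastUp d then q ^ pwt 0 d else 0

/-- Weighted count of all paths. -/
def Al (n : ℕ) (b : ℤ) : F :=
  ∑ d : Fin n → Fin 3, if ValidPath ν s b d then q ^ pwt 0 d else 0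

lemma Al_eq (n : ℕ) (b : ℤ) : Al q ν s n b = Up q ν s n b + Dn q ν s n b := by
  unfold Al Up Dn
  rw [← Finset.sum_add_distrib]
  apply Finset.sum_congr rfl
  intro d _
  by_cases h : ValidPath ν s b d <;> by_cases h' : lastUp d <;> simp [h, h']

lemma sum_snoc (n : ℕ) (g : (Fin (n + 1) → Fin 3) → F) :
    ∑ d, g d = ∑ x : Fin 3, ∑ d : Fin n → Fin 3, g (Fin.snoc d x) := by
  rw [← Fintype.sum_prod_type' (fun (x : Fin 3) (d : Fin n → Fin 3) => g (Fin.snoc d x))]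
  exact (Equiv.sum_comp (Fin.snocEquiv (fun _ : Fin (n + 1) => Fin 3)) g).symm

lemma Up_succ (n : ℕ) (b : ℤ) : Up q ν s (n + 1) b = Al q ν s n (b - 1) := by
  unfold Up Al
  rw [sum_snoc, Fin.sum_univ_three]
  simp only [valid_snoc, lastUp_snoc, pwt_snoc]
  simp [stepVal]

lemma Dn_succ (hq : q ≠ 0) (n : ℕ) (b : ℤ) : Dn q ν s (n + 1) b =
    (if 0 < b + 1 then Dn q ν s n (b + 1) +
      (if b + 1 ≤ ν then q ^ n * Up q ν s n (b + 1) else 0) else 0) +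
    (if b = 0 then Al q ν s n b else 0) := by
  unfold Dn Al Up
  rw [sum_snoc, Fin.sum_univ_three]
  simp only [valid_snoc, lastUp_snoc, pwt_snoc]
  have e0 : stepVal 0 = 1 := rfl
  have e1 : stepVal 1 = -1 := rfl
  have e2 : stepVal 2 = 0 := rfl
  simp only [e0, e1, e2, sub_neg_eq_add, sub_zero]
  simp only [not_true_eq_false, and_false, if_false, Finset.sum_const_zero, zero_add]
  congr 1
  · by_cases hb : 0 < b + 1
    · rw [if_pos hb]
      by_cases hv : b + 1 ≤ (ν : ℤ)
      · rw [if_pos hv, Finset.mul_sum, ← Finset.sum_add_distrib]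
        apply Finset.sum_congr rfl
        intro d _
        by_cases h : ValidPath ν s (b + 1) d <;> by_cases h' : lastUp d <;>
          simp [h, h', hb, hv, zpow_add₀ hq, mul_comm]
      · rw [if_neg hv, add_zero]
        apply Finset.sum_congr rfl
        intro d _
        by_cases h : ValidPath ν s (b + 1) d <;> by_cases h' : lastUp d <;>
          simp [h, h', hb, hv]
    · rw [if_neg hb]
      apply Finset.sum_eq_zero
      intro d _
      simp [hb]
  · by_cases hb : b = 0
    · subst hb; simp
    · simp [hb]

lemma not_lastUp_zero (d : Fin 0 → Fin 3) : ¬ lastUp d := by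
  rintro ⟨h, _⟩; omega

lemma Up_zero (b : ℤ) : Up q ν s 0 b = 0 := by
  unfold Up
  apply Finset.sum_eq_zero
  intro d _
  simp [not_lastUp_zero]

lemma Dn_zero (b : ℤ) : Dn q ν s 0 b = if s = b then 1 else 0 := by
  unfold Dn
  rw [Fintype.sum_unique]
  suffices hd : ∀ d : Fin 0 → Fin 3, (if ValidPath ν s b d ∧ ¬ lastUp d then q ^ pwt 0 d else 0) =
      if s = b then 1 else 0 from hd _
  intro d
  have h : ∀ k, ¬ IsPeak d k := fun k => not_isPeak_ge _ _ (Nat.zero_le k)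
  have hv : ValidPath ν s b d ↔ s = b := by
    unfold ValidPath
    constructor
    · rintro ⟨h1, _⟩
      simpa [hts] using h1
    · intro h1
      exact ⟨by simpa [hts] using h1, fun k => k.elim0, fun k hk => absurd hk (h k)⟩
  have hw : pwt 0 d = 0 := by
    unfold pwt
    exact Finset.sum_eq_zero fun k _ => if_neg (h k)
  simp only [hv, not_lastUp_zero, hw, not_false_eq_true, and_true, zpow_zero]

lemma UD_neg (hq : q ≠ 0) (hs : 0 ≤ s) (n : ℕ) : ∀ b : ℤ, b < 0 → Al q ν s n b = 0 := by
  induction n with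
  | zero =>
    intro b hb
    rw [Al_eq, Up_zero, Dn_zero, if_neg (by omega)]; simp
  | succ n ih =>
    intro b hb
    rw [Al_eq, Up_succ, Dn_succ q ν s hq, ih _ (by omega), if_neg (by omega), if_neg (by omega)]
    simp

lemma Dn_big (hq : q ≠ 0) (hs : s ≤ ν) (n : ℕ) : ∀ b : ℤ, (ν : ℤ) < b → Dn q ν s n b = 0 := by
  induction n with
  | zero =>
    intro b hb
    rw [Dn_zero, if_neg (by omega)]
  | succ n ih =>
    intro b hb
    rw [Dn_succ q ν s hq, ih _ (by omega), if_neg (show ¬ b + 1 ≤ (ν : ℤ) by omega),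
      if_neg (show ¬ b = 0 by omega)]
    simp

lemma Al_zero (b : ℤ) : Al q ν s 0 b = if s = b then 1 else 0 := by
  rw [Al_eq, Up_zero, Dn_zero, zero_add]

lemma Al_top (hq : q ≠ 0) (hν : 1 ≤ ν) (hs : s ≤ ν) (n : ℕ) :
    Al q ν s (n + 1) ν = Al q ν s n (ν - 1) := by
  rw [Al_eq, Up_succ, Dn_succ q ν s hq, Dn_big q ν s hq hs n _ (by omega),
      if_neg (show ¬ (ν : ℤ) + 1 ≤ (ν : ℤ) by omega),
      if_neg (show ¬ (ν : ℤ) = 0 by omega)]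
  simp

lemma pow_Up (n : ℕ) (b : ℤ) :
    (q ^ n - 1) * Up q ν s n (b + 1) = (q ^ n - 1) * Al q ν s (n - 1) b := by
  cases n with
  | zero => simp
  | succ n => rw [Up_succ]; simp

lemma Al_mid (hq : q ≠ 0) (n : ℕ) (b : ℤ) (h0 : 0 < b) (h1 : b < ν) :
    Al q ν s (n + 1) b = Al q ν s n (b - 1) + Al q ν s n (b + 1) +
      (q ^ n - 1) * Al q ν s (n - 1) b := by
  rw [← pow_Up, Al_eq q ν s (n + 1), Up_succ, Dn_succ q ν s hq, if_pos (by omega), if_pos (by omega),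
    if_neg (by omega), Al_eq q ν s n (b + 1)]
  ring

lemma Al_bot (hq : q ≠ 0) (hν : 1 ≤ ν) (hs : 0 ≤ s) (n : ℕ) :
    Al q ν s (n + 1) 0 = Al q ν s n 0 + Al q ν s n 1 +
      (q ^ n - 1) * Al q ν s (n - 1) 0 := by
  rw [← pow_Up, Al_eq q ν s (n + 1), Up_succ, Dn_succ q ν s hq, if_pos (by omega), if_pos (by omega),
    if_pos rfl, UD_neg q ν s hq hs n _ (by omega), zero_add 1, Al_eq q ν s n 1]
  ring

lemma Cpoly_eq (L s' b' : ℕ) : Cpoly ν 0 (L : ℤ) s' b' q = Al q ν (s' : ℤ) L b' := by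
  unfold Cpoly Al
  rw [Finset.sum_filter]
  have : ((L : ℤ) - 0).toNat = L := by simp
  rw [this]

end paths

/-! ### Helper lemmas: q-binomial side -/

section binom
variable {F : Type*} [Field F] (q : F)

lemma qP_succ (n : ℕ) : qP q (n + 1) = qP q n * (1 - q ^ (n + 1)) := by
  unfold qP; rw [Finset.prod_range_succ]

lemma qP_ne (hr : ∀ n : ℕ, 1 - q ^ (n + 1) ≠ 0) (n : ℕ) : qP q n ≠ 0 := by
  unfold qP; exact Finset.prod_ne_zero_iff.mpr fun j _ => hr j

lemma qB_nat (a c : ℕ) : qB q ((a : ℤ) + c) a = qP q (a + c) / (qP q a * qP q c) := by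
  unfold qB
  rw [if_pos (by omega)]
  have h1 : ((a : ℤ) + c).toNat = a + c := by omega
  have h2 : ((a : ℤ) + c - a).toNat = c := by omega
  rw [h1, h2, Int.toNat_natCast]

lemma qB_out (N k : ℤ) (h : ¬ (0 ≤ k ∧ k ≤ N)) : qB q N k = 0 := if_neg h

lemma qB_symm (N k : ℤ) : qB q N (N - k) = qB q N k := by
  by_cases h : 0 ≤ k ∧ k ≤ N
  · unfold qB
    rw [if_pos h, if_pos (by omega), sub_sub_cancel, mul_comm]
  · rw [qB_out q _ _ h, qB_out q _ _ (by omega)]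

lemma qB_pascal (hq : q ≠ 0) (hr : ∀ n : ℕ, 1 - q ^ (n + 1) ≠ 0) (N k : ℤ) (hN : 0 ≤ N) :
    qB q (N + 1) k = qB q N k + q ^ (N + 1 - k) * qB q N (k - 1) := by
  have hP := qP_ne q hr
  by_cases h : 0 ≤ k ∧ k ≤ N + 1
  · obtain ⟨h0, h1⟩ := h
    obtain ⟨a, rfl⟩ := Int.eq_ofNat_of_zero_le h0
    obtain ⟨c, hc⟩ := Int.eq_ofNat_of_zero_le (sub_nonneg.2 h1)
    obtain rfl : N = a + c - 1 := by omega
    rcases a with _ | a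
    · rcases c with _ | c
      · simp at hN
      rw [qB_out q _ (((0 : ℕ) : ℤ) - 1) (by omega)]
      have e1 := qB_nat q 0 (c + 1)
      have e2 := qB_nat q 0 c
      have t1 : (((0 : ℕ) : ℤ) + ((c + 1 : ℕ) : ℤ) - 1 + 1) = ((0 : ℕ) : ℤ) + ((c + 1 : ℕ) : ℤ) := by ring
      have t2 : (((0 : ℕ) : ℤ) + ((c + 1 : ℕ) : ℤ) - 1) = ((0 : ℕ) : ℤ) + (c : ℤ) := by push_cast; ring
      rw [t1, t2, e1, e2]
      simp [hP, qP]
      rw [div_self, div_self]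
      · exact hP c
      · exact hP (c + 1)
    · rcases c with _ | c
      · have z := qB_out q ((a : ℤ) + ((0 : ℕ) : ℤ)) ((a + 1 : ℕ) : ℤ) (by push_cast; omega)
        have e1 := qB_nat q (a + 1) 0
        have e2 := qB_nat q a 0
        have t1 : (((a + 1 : ℕ) : ℤ) + ((0 : ℕ) : ℤ) - 1 + 1) = ((a + 1 : ℕ) : ℤ) + ((0 : ℕ) : ℤ) := by ring
        have t2 : (((a + 1 : ℕ) : ℤ) + ((0 : ℕ) : ℤ) - 1) = (a : ℤ) + ((0 : ℕ) : ℤ) := by push_cast; ring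
        have t3 : (((a + 1 : ℕ) : ℤ) - 1) = (a : ℤ) := by push_cast; ring
        rw [t1, t2, t3, e1, e2, z]
        have hP0 : qP q 0 = 1 := by simp [qP]
        simp only [add_zero, hP0, mul_one]
        rw [div_self (hP a), div_self (hP (a + 1))]
        simp
      · have e1 := qB_nat q (a + 1) (c + 1)
        have e2 := qB_nat q (a + 1) c
        have e3 := qB_nat q a (c + 1)
        have t1 : (((a + 1 : ℕ) : ℤ) + ((c + 1 : ℕ) : ℤ) - 1 + 1) = ((a + 1 : ℕ) : ℤ) + ((c + 1 : ℕ) : ℤ) := by ring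
        have t2 : (((a + 1 : ℕ) : ℤ) + ((c + 1 : ℕ) : ℤ) - 1) = ((a + 1 : ℕ) : ℤ) + (c : ℤ) := by push_cast; ring
        have t2' : ((a + 1 : ℕ) : ℤ) + (c : ℤ) = (a : ℤ) + ((c + 1 : ℕ) : ℤ) := by push_cast; ring
        have t3 : (((a + 1 : ℕ) : ℤ) - 1) = (a : ℤ) := by push_cast; ring
        have t4 : ((a + 1 : ℕ) : ℤ) + ((c + 1 : ℕ) : ℤ) - ((a + 1 : ℕ) : ℤ) = ((c + 1 : ℕ) : ℤ) := by ring
        rw [t1, t2, t3, e1, e2, t2', e3, t4, zpow_natCast]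
        have s1 : a + 1 + (c + 1) = (a + c + 1) + 1 := by ring
        have s2 : a + 1 + c = a + c + 1 := by ring
        have s3 : a + (c + 1) = a + c + 1 := by ring
        rw [s1, s2, s3, qP_succ q (a + c + 1), qP_succ q a, qP_succ q c]
        have := hr a
        have := hr c
        have := hP a
        have := hP c
        field_simp
        ring
  · rw [qB_out q _ _ h, qB_out q _ _ (by omega), qB_out q _ _ (by omega)]; simp

lemma qB_absorb (hr : ∀ n : ℕ, 1 - q ^ (n + 1) ≠ 0) (N k : ℤ) (hN : 0 ≤ N) :
    (1 - q ^ (N - k)) * qB q N k = (1 - q ^ N) * qB q (N - 1) k := by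
  have hP := qP_ne q hr
  by_cases h : 0 ≤ k ∧ k ≤ N
  · obtain ⟨h0, h1⟩ := h
    obtain ⟨a, rfl⟩ := Int.eq_ofNat_of_zero_le h0
    obtain ⟨c, hc⟩ := Int.eq_ofNat_of_zero_le (sub_nonneg.2 h1)
    obtain rfl : N = a + c := by omega
    rcases c with _ | c
    · rw [qB_out q (_ - 1) _ (by omega)]; simp
    · have t2 : ((a : ℤ) + ((c + 1 : ℕ) : ℤ) - 1) = (a : ℤ) + (c : ℤ) := by push_cast; ring
      have t3 : ((a : ℤ) + ((c + 1 : ℕ) : ℤ) - a) = ((c + 1 : ℕ) : ℤ) := by ring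
      have t4 : ((a : ℤ) + ((c + 1 : ℕ) : ℤ)) = ((a + (c + 1) : ℕ) : ℤ) := by push_cast; ring
      rw [t2, t3, qB_nat, qB_nat, t4, zpow_natCast, zpow_natCast]
      rw [← add_assoc a c 1, qP_succ q (a + c), qP_succ q c]
      have := hr c
      have := hP a
      have := hP c
      field_simp
  · rw [qB_out q _ _ h, qB_out q _ _ (by omega)]; simp

lemma qB_three (hq : q ≠ 0) (hr : ∀ n : ℕ, 1 - q ^ (n + 1) ≠ 0) (N k : ℤ) (hN : 0 ≤ N) :
    qB q (N + 1) k = qB q N k + qB q N (k - 1) + (q ^ N - 1) * qB q (N - 1) (k - 1) := by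
  have h1 := qB_pascal q hq hr N k hN
  have h2 := qB_absorb q hr N (k - 1) hN
  have e : N - (k - 1) = N + 1 - k := by ring
  rw [e] at h2
  linear_combination h1 - h2

/-- The two halves of `B`. -/
def T (K : ℤ) (e : ℤ → ℤ) (N c : ℤ) : F :=
  ∑ᶠ j : ℤ, q ^ e j * qB q N (c + j * K)

lemma T_fin (K : ℤ) (hK : 0 < K) (e : ℤ → ℤ) (N c : ℤ) :
    (Function.support fun j : ℤ => q ^ e j * qB q N (c + j * K)).Finite := by
  have hinj : Function.Injective (fun j : ℤ => c + j * K) := by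
    intro a b h
    have h' : a * K = b * K := by simpa using h
    exact mul_right_cancel₀ hK.ne' h'
  refine ((Set.finite_Icc (0 : ℤ) N).preimage hinj.injOn).subset ?_
  intro j hj
  by_contra hcon
  apply hj
  have : ¬ (0 ≤ c + j * K ∧ c + j * K ≤ N) := hcon
  simp [qB_out q _ _ this]

lemma B_eq (ν : ℕ) (s b : ℤ) (L : ℕ) :
    B ν s b L q =
      T q (2 * (ν : ℤ) + 3) (fun j => j * ((2 * j + 1) * (2 * (ν : ℤ) + 3) - 2 * s)) L (((L : ℤ) + b - s) / 2)
      - T q (2 * (ν : ℤ) + 3) (fun j => (2 * j + 1) * ((2 * (ν : ℤ) + 3) * j + s)) L (((L : ℤ) + b + s) / 2) := by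
  unfold B T
  exact finsum_sub_distrib (T_fin q _ (by omega) _ _ _) (T_fin q _ (by omega) _ _ _)

lemma T_three (hq : q ≠ 0) (hr : ∀ n : ℕ, 1 - q ^ (n + 1) ≠ 0) (K : ℤ) (hK : 0 < K)
    (e : ℤ → ℤ) (N c : ℤ) (hN : 0 ≤ N) :
    T q K e (N + 1) c = T q K e N c + T q K e N (c - 1) + (q ^ N - 1) * T q K e (N - 1) (c - 1) := by
  unfold T
  have f1 := T_fin q K hK e N c
  have f2 := T_fin q K hK e N (c - 1)
  have f3 := T_fin q K hK e (N - 1) (c - 1)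
  rw [mul_finsum' _ _ f3, ← finsum_add_distrib f1 f2, ← finsum_add_distrib]
  · apply finsum_congr
    intro j
    rw [qB_three q hq hr N _ hN]
    have : c + j * K - 1 = c - 1 + j * K := by ring
    rw [this]; ring
  · exact (f1.union f2).subset (Function.support_add _ _)
  · refine f3.subset ?_
    intro j hj hj'
    apply hj
    simp only at hj' ⊢
    rw [hj', mul_zero]

lemma B_three (hq : q ≠ 0) (hr : ∀ n : ℕ, 1 - q ^ (n + 1) ≠ 0) (ν : ℕ) (s b : ℤ) (L : ℕ)
    (hp : (2 : ℤ) ∣ L + 1 + b - s) :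
    B ν s b (L + 1) q = B ν s (b + 1) L q + B ν s (b - 1) L q
      + (q ^ L - 1) * B ν s b (L - 1) q := by
  obtain ⟨m, hm⟩ := hp
  have hK : (0 : ℤ) < 2 * (ν : ℤ) + 3 := by omega
  have key : ∀ L' : ℤ, L' = (L : ℤ) - 1 → (q ^ L - 1) * B ν s b (L - 1) q =
      (q ^ (L : ℤ) - 1) * (T q (2 * (ν : ℤ) + 3) (fun j => j * ((2 * j + 1) * (2 * (ν : ℤ) + 3) - 2 * s)) L' (m - 1)
      - T q (2 * (ν : ℤ) + 3) (fun j => (2 * j + 1) * ((2 * (ν : ℤ) + 3) * j + s)) L' (m + s - 1)) := by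
    intro L' hL'
    rcases L with _ | L
    · simp
    · rw [zpow_natCast, Nat.add_sub_cancel, B_eq]
      have e1 : L' = (L : ℤ) := by rw [hL']; push_cast; ring
      have e2 : ((L : ℤ) + b - s) / 2 = m - 1 := by push_cast at hm; omega
      have e3 : ((L : ℤ) + b + s) / 2 = m + s - 1 := by push_cast at hm; omega
      rw [e1, e2, e3]
  rw [key _ rfl, B_eq, B_eq, B_eq]
  have a1 : (((L + 1 : ℕ) : ℤ) + b - s) / 2 = m := by push_cast; omega
  have a2 : (((L + 1 : ℕ) : ℤ) + b + s) / 2 = m + s := by push_cast; omega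
  have a3 : ((L : ℤ) + (b + 1) - s) / 2 = m := by omega
  have a4 : ((L : ℤ) + (b + 1) + s) / 2 = m + s := by omega
  have a5 : ((L : ℤ) + (b - 1) - s) / 2 = m - 1 := by omega
  have a6 : ((L : ℤ) + (b - 1) + s) / 2 = m + s - 1 := by omega
  rw [a1, a2, a3, a4, a5, a6]
  have cst : ((L + 1 : ℕ) : ℤ) = (L : ℤ) + 1 := by push_cast; ring
  rw [cst, T_three q hq hr _ hK _ _ _ (by omega), T_three q hq hr _ hK _ _ _ (by omega)]
  ring

lemma T_pascal (hq : q ≠ 0) (hr : ∀ n : ℕ, 1 - q ^ (n + 1) ≠ 0) (K : ℤ) (hK : 0 < K)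
    (e : ℤ → ℤ) (N c : ℤ) (hN : 0 ≤ N) :
    T q K e (N + 1) c = T q K e N c + T q K (fun j => e j + (N + 1 - (c + j * K))) N (c - 1) := by
  unfold T
  have f1 := T_fin q K hK e N c
  have f2 := T_fin q K hK (fun j => e j + (N + 1 - (c + j * K))) N (c - 1)
  rw [← finsum_add_distrib f1 f2]
  apply finsum_congr
  intro j
  rw [qB_pascal q hq hr N _ hN]
  have : c + j * K - 1 = c - 1 + j * K := by ring
  rw [this, zpow_add₀ hq]; ring

lemma T_refl (K : ℤ) (e e' : ℤ → ℤ) (N c c' t : ℤ) (hc : c' = N - c - t * K)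
    (he : ∀ i, e' (t - i) = e i) : T q K e' N c' = T q K e N c := by
  unfold T
  refine (finsum_comp_equiv (Equiv.subLeft t)).symm.trans (finsum_congr ?_)
  intro i
  simp only [Equiv.subLeft_apply]
  rw [he, ← qB_symm]
  congr 2
  rw [hc]; ring

lemma B_symm (ν : ℕ) (s b s' b' : ℤ) (L : ℕ) (hs : s' = 2 * (ν : ℤ) + 3 - s)
    (hb : b' = 2 * (ν : ℤ) + 3 - b) (hp : (2 : ℤ) ∣ L + b - s) :
    B ν s' b' L q = B ν s b L q := by
  obtain ⟨m, hm⟩ := hp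
  rw [B_eq, B_eq]
  have a1 : ((L : ℤ) + b - s) / 2 = m := by omega
  have a2 : ((L : ℤ) + b + s) / 2 = m + s := by omega
  have a3 : ((L : ℤ) + b' - s') / 2 = L - m := by omega
  have a4 : ((L : ℤ) + b' + s') / 2 = L - m - s + (2 * (ν : ℤ) + 3) := by omega
  rw [a1, a2, a3, a4]
  congr 1
  · apply T_refl q _ _ _ _ _ _ 0
    · ring
    · intro i; rw [hs]; ring
  · apply T_refl q _ _ _ _ _ _ (-1)
    · ring
    · intro i; rw [hs]; ring

lemma B_top (hq : q ≠ 0) (hr : ∀ n : ℕ, 1 - q ^ (n + 1) ≠ 0) (ν : ℕ) (s : ℤ) (L : ℕ)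
    (hp : (2 : ℤ) ∣ L - s) : B ν s 1 (L + 1) q = B ν s 2 L q := by
  obtain ⟨m, hm⟩ := hp
  have hK : (0 : ℤ) < 2 * (ν : ℤ) + 3 := by omega
  rw [B_eq, B_eq]
  have a1 : (((L + 1 : ℕ) : ℤ) + 1 - s) / 2 = m + 1 := by push_cast; omega
  have a2 : (((L + 1 : ℕ) : ℤ) + 1 + s) / 2 = m + s + 1 := by push_cast; omega
  have a3 : ((L : ℤ) + 2 - s) / 2 = m + 1 := by omega
  have a4 : ((L : ℤ) + 2 + s) / 2 = m + s + 1 := by omega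
  have cst : ((L + 1 : ℕ) : ℤ) = (L : ℤ) + 1 := by push_cast; ring
  rw [a1, a2, a3, a4, cst, T_pascal q hq hr _ hK _ _ _ (by omega),
    T_pascal q hq hr _ hK _ _ _ (by omega)]
  have hL : (L : ℤ) = 2 * m + s := by omega
  rw [T_refl q _ (fun j => (2 * j + 1) * ((2 * (ν : ℤ) + 3) * j + s) +
      ((L : ℤ) + 1 - (m + s + 1 + j * (2 * (ν : ℤ) + 3)))) _ (L : ℤ) (m + s + 1 - 1) (m + 1 - 1) 0]
  · ring
  · rw [hL]; ring
  · intro i; rw [hL]; ring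

lemma T_zero_none (K : ℤ) (e : ℤ → ℤ) (c : ℤ) (h : ∀ j, c + j * K ≠ 0) : T q K e 0 c = 0 := by
  unfold T
  apply finsum_eq_zero_of_forall_eq_zero
  intro j
  rw [qB_out q _ _ (fun h' => h j (le_antisymm h'.2 h'.1)), mul_zero]

lemma B_zero (ν : ℕ) (s b : ℤ) (hp : (2 : ℤ) ∣ b - s) (h1 : b - s < 2 * (2 * (ν : ℤ) + 3))
    (h2 : -(2 * (2 * (ν : ℤ) + 3)) < b - s) (h3 : 0 < b + s) (h4 : b + s < 2 * (2 * (ν : ℤ) + 3)) :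
    B ν s b 0 q = if s = b then 1 else 0 := by
  obtain ⟨m, hm⟩ := hp
  rw [B_eq]
  have a1 : (((0 : ℕ) : ℤ) + b - s) / 2 = m := by push_cast; omega
  have a2 : (((0 : ℕ) : ℤ) + b + s) / 2 = m + s := by push_cast; omega
  rw [a1, a2, Nat.cast_zero]
  have n2 : ∀ j : ℤ, m + s + j * (2 * (ν : ℤ) + 3) ≠ 0 := by
    intro j hj
    have u1 : j < 0 := by
      by_contra hc
      have : 0 ≤ j * (2 * (ν : ℤ) + 3) := mul_nonneg (by omega) (by omega)
      omega
    have : 0 ≤ (-1 - j) * (2 * (ν : ℤ) + 3) := mul_nonneg (by omega) (by omega)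
    have e : (-1 - j) * (2 * (ν : ℤ) + 3) = -(2 * (ν : ℤ) + 3) - j * (2 * (ν : ℤ) + 3) := by ring
    omega
  have n1 : ∀ j : ℤ, m + j * (2 * (ν : ℤ) + 3) = 0 → j = 0 := by
    intro j hj
    rcases lt_trichotomy j 0 with u | u | u
    · have : 0 ≤ (-1 - j) * (2 * (ν : ℤ) + 3) := mul_nonneg (by omega) (by omega)
      have e : (-1 - j) * (2 * (ν : ℤ) + 3) = -(2 * (ν : ℤ) + 3) - j * (2 * (ν : ℤ) + 3) := by ring
      omega
    · exact u
    · have : 0 ≤ (j - 1) * (2 * (ν : ℤ) + 3) := mul_nonneg (by omega) (by omega)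
      have e : (j - 1) * (2 * (ν : ℤ) + 3) = j * (2 * (ν : ℤ) + 3) - (2 * (ν : ℤ) + 3) := by ring
      omega
  rw [T_zero_none q _ _ _ n2, sub_zero]
  by_cases hsb : s = b
  · rw [if_pos hsb]
    obtain rfl : m = 0 := by omega
    unfold T
    rw [finsum_eq_single _ (0 : ℤ)]
    · simp [qB, qP]
    · intro j hj
      rw [qB_out q _ _ (fun h' => hj (n1 j (le_antisymm h'.2 h'.1))), mul_zero]
  · rw [if_neg hsb]
    apply T_zero_none
    intro j hj
    have := n1 j hj
    subst this
    omega

/-- The main induction. -/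
lemma main_ind (hq : q ≠ 0) (hr : ∀ n : ℕ, 1 - q ^ (n + 1) ≠ 0) (ν : ℕ) (hν : 1 ≤ ν) (s : ℤ)
    (hs0 : 0 ≤ s) (hs : s ≤ ν) (L : ℕ) : ∀ b : ℤ, 0 ≤ b → b ≤ ν →
    ((2 : ℤ) ∣ L + s + b → Al q ν s L b = B ν ((ν : ℤ) + 1 - s) ((ν : ℤ) + 1 - b) L q) ∧
    (¬ (2 : ℤ) ∣ L + s + b → Al q ν s L b = B ν ((ν : ℤ) + 2 + s) ((ν : ℤ) + 1 - b) L q) := by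
  induction L using Nat.strong_induction_on with
  | _ L ih =>
  intro b hb0 hb
  rcases L with _ | L
  · constructor
    · intro hp
      rw [Al_zero, B_zero q _ _ _ (by omega) (by omega) (by omega) (by omega) (by omega)]
      by_cases h : s = b
      · rw [if_pos h, if_pos (by omega)]
      · rw [if_neg h, if_neg (by omega)]
    · intro hp
      rw [Al_zero, B_zero q _ _ _ (by omega) (by omega) (by omega) (by omega) (by omega),
        if_neg (by omega), if_neg (by omega)]
  have ih1 := ih L (by omega)
  -- the correction term
  have ihE : (2 : ℤ) ∣ ((L + 1 : ℕ) : ℤ) + s + b → (q ^ L - 1) * Al q ν s (L - 1) b =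
      (q ^ L - 1) * B ν ((ν : ℤ) + 1 - s) ((ν : ℤ) + 1 - b) (L - 1) q := by
    intro hp
    rcases L with _ | L
    · simp
    · rw [(ih (L + 1 - 1) (by omega) b hb0 hb).1 (by push_cast at hp ⊢; omega)]
  have ihO : ¬ (2 : ℤ) ∣ ((L + 1 : ℕ) : ℤ) + s + b → (q ^ L - 1) * Al q ν s (L - 1) b =
      (q ^ L - 1) * B ν ((ν : ℤ) + 2 + s) ((ν : ℤ) + 1 - b) (L - 1) q := by
    intro hp
    rcases L with _ | L
    · simp
    · rw [(ih (L + 1 - 1) (by omega) b hb0 hb).2 (by push_cast at hp ⊢; omega)]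
  rcases eq_or_lt_of_le hb with rfl | hlt
  · -- top boundary
    have e1 : (ν : ℤ) + 1 - ν = 1 := by ring
    have e2 : (ν : ℤ) + 1 - (ν - 1) = 2 := by ring
    rw [Al_top q ν s hq hν hs, e1]
    have := ih1 ((ν : ℤ) - 1) (by omega) (by omega)
    rw [e2] at this
    constructor
    · intro hp
      rw [this.1 (by omega), B_top q hq hr _ _ _ (by omega)]
    · intro hp
      rw [this.2 (by omega), B_top q hq hr _ _ _ (by omega)]
  rcases eq_or_lt_of_le hb0 with rfl | hgt
  · -- bottom boundary
    rw [Al_bot q ν s hq hν hs0]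
    have i0 := ih1 0 le_rfl (by omega)
    have i1 := ih1 1 (by omega) (by omega)
    have e1 : (ν : ℤ) + 1 - 0 - 1 = ν + 1 - 1 := by ring
    constructor
    · intro hp
      rw [ihE hp, i0.2 (by omega), i1.1 (by omega), B_three q hq hr _ _ _ _ (by omega), e1,
        B_symm q ν ((ν : ℤ) + 1 - s) ((ν : ℤ) + 1 - 0 + 1) ((ν : ℤ) + 2 + s) ((ν : ℤ) + 1 - 0) L
          (by ring) (by ring) (by omega)]
    · intro hp
      rw [ihO hp, i0.1 (by omega), i1.2 (by omega), B_three q hq hr _ _ _ _ (by omega), e1,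
        B_symm q ν ((ν : ℤ) + 2 + s) ((ν : ℤ) + 1 - 0 + 1) ((ν : ℤ) + 1 - s) ((ν : ℤ) + 1 - 0) L
          (by ring) (by ring) (by omega)]
  · rw [Al_mid q ν s hq L b hgt hlt]
    have i0 := ih1 (b - 1) (by omega) (by omega)
    have i1 := ih1 (b + 1) (by omega) (by omega)
    have e1 : (ν : ℤ) + 1 - (b - 1) = ν + 1 - b + 1 := by ring
    have e2 : (ν : ℤ) + 1 - (b + 1) = ν + 1 - b - 1 := by ring
    rw [e1] at i0
    rw [e2] at i1
    constructor
    · intro hp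
      rw [ihE hp, i0.1 (by omega), i1.1 (by omega), B_three q hq hr _ _ _ _ (by omega)]
    · intro hp
      rw [ihO hp, i0.2 (by omega), i1.2 (by omega), B_three q hq hr _ _ _ _ (by omega)]

end binom

lemma X_pow_ne (n : ℕ) : (1 : K) - RatFunc.X ^ (n + 1) ≠ 0 := by
  intro h
  have h1 : (RatFunc.X : K) ^ (n + 1) = 1 := (sub_eq_zero.1 h).symm
  rw [← RatFunc.algebraMap_X, ← map_pow, ← map_one (algebraMap (Polynomial ℚ) (RatFunc ℚ))] at h1
  have h2 := RatFunc.algebraMap_injective ℚ h1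
  have h3 := congrArg Polynomial.natDegree h2
  simp at h3

theorem stmt_7 (ν : ℕ) (hν : 1 ≤ ν) (s b : ℕ) (hs : s ≤ ν) (hb : b ≤ ν) (L : ℕ) :
    ((L : ℤ) ≡ (s : ℤ) + b [ZMOD 2] →
      Cpoly ν 0 (L : ℤ) s b (RatFunc.X : K) =
        B ν ((ν : ℤ) + 1 - s) ((ν : ℤ) + 1 - b) L RatFunc.X) ∧
    (¬ (L : ℤ) ≡ (s : ℤ) + b [ZMOD 2] →
      Cpoly ν 0 (L : ℤ) s b (RatFunc.X : K) =
        B ν ((ν : ℤ) + 2 + s) ((ν : ℤ) + 1 - b) L RatFunc.X) := by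
  have h := main_ind (RatFunc.X : K) RatFunc.X_ne_zero X_pow_ne ν hν (s : ℤ) (by omega)
    (by omega) L (b : ℤ) (by omega) (by omega)
  have hm : (L : ℤ) ≡ (s : ℤ) + b [ZMOD 2] ↔ (2 : ℤ) ∣ L + s + b := by
    unfold Int.ModEq; omega
  rw [Cpoly_eq, hm]
  exact h

end
end
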